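/- Let R be a ring and 𝒯 a full additive subcategory of the category Mod R of left R-modules that is closed under extensions and satisfies 𝒫(Mod R) ⊆ 𝒯 ⊆ ^⊥𝒫(Mod R), where 𝒫(Mod R) is the class of projective left R-modules. Then for every left R-module A with pd_R A < ∞, one has pd_R A = 𝒯-dim A. -/

import Mathlib

open CategoryTheory CategoryTheory.Limits CategoryTheory.Abelian ZeroObject

universe w v u

namespace RelHomDim

variable {𝒜 : Type u} [Category.{v} 𝒜] [Abelian 𝒜]

/-- A class of objects of an abelian category corresponding to a full additive
subcategory: it is closed under isomorphisms, contains a zero object and is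
closed under finite direct sums (biproducts). -/
def IsAdditiveClass (P : 𝒜 → Prop) : Prop :=
  P 0 ∧ (∀ ⦃X Y : 𝒜⦄, (X ≅ Y) → P X → P Y) ∧ ∀ ⦃X Y : 𝒜⦄, P X → P Y → P (X ⊞ Y)

/-- A class of objects is closed under direct summands. -/
def ClosedUnderSummands (P : 𝒜 → Prop) : Prop :=
  ∀ X Y : 𝒜, P (X ⊞ Y) → P X ∧ P Y

/-- `Hom(W,-)`-exactness of a short exact sequence `0 → X₁ → X₂ → X₃ → 0`:
the induced sequence `0 → Hom(W,X₁) → Hom(W,X₂) → Hom(W,X₃) → 0` is exact. -/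
def CovHomExact (W : 𝒜) (S : ShortComplex 𝒜) : Prop :=
  (∀ a b : W ⟶ S.X₁, a ≫ S.f = b ≫ S.f → a = b) ∧
  (∀ b : W ⟶ S.X₂, b ≫ S.g = 0 → ∃ a : W ⟶ S.X₁, a ≫ S.f = b) ∧
  (∀ c : W ⟶ S.X₃, ∃ b : W ⟶ S.X₂, b ≫ S.g = c)

/-- A short exact sequence is `ℰ`-proper (i.e. `Hom(ℰ,-)`-exact) if it is
`Hom(E,-)`-exact for every object `E` in the class `ℰ`. -/
def EProper (E : 𝒜 → Prop) (S : ShortComplex 𝒜) : Prop :=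
  ∀ W, E W → CovHomExact W S

/-- `ResW P W n K A` holds iff there is an exact sequence
`0 → K → X_{n-1} → ⋯ → X_0 → A → 0` in `𝒜` with all the `n` middle terms `X i`
in `P`, such that each of the short exact sequences obtained by splicing
satisfies `W` (this encodes, e.g., `Hom(ℰ,-)`-exactness of the whole sequence). -/
def ResW (P : 𝒜 → Prop) (W : ShortComplex 𝒜 → Prop) : ℕ → 𝒜 → 𝒜 → Prop
  | 0 => fun K A => Nonempty (K ≅ A)
  | n + 1 => fun K A => ∃ (B X : 𝒜) (f : B ⟶ X) (g : X ⟶ A) (w : f ≫ g = 0),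
      P X ∧ (ShortComplex.mk f g w).ShortExact ∧ W (ShortComplex.mk f g w) ∧
      ResW P W n K B

/-- `Res P n K A` : there is an exact sequence `0 → K → X_{n-1} → ⋯ → X_0 → A → 0`
with all middle terms in `P`. -/
abbrev Res (P : 𝒜 → Prop) : ℕ → 𝒜 → 𝒜 → Prop := ResW P fun _ => True

/-- `CoresW P W n A K` holds iff there is an exact sequence
`0 → A → X^0 → ⋯ → X^{n-1} → K → 0` with all middle terms in `P` and each
spliced short exact piece satisfying `W`. -/
def CoresW (P : 𝒜 → Prop) (W : ShortComplex 𝒜 → Prop) : ℕ → 𝒜 → 𝒜 → Prop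
  | 0 => fun A K => Nonempty (A ≅ K)
  | n + 1 => fun A K => ∃ (X B : 𝒜) (f : A ⟶ X) (g : X ⟶ B) (w : f ≫ g = 0),
      P X ∧ (ShortComplex.mk f g w).ShortExact ∧ W (ShortComplex.mk f g w) ∧
      CoresW P W n B K

/-- `Cores P n A K` : there is an exact sequence `0 → A → X^0 → ⋯ → X^{n-1} → K → 0`
with all middle terms in `P`. -/
abbrev Cores (P : 𝒜 → Prop) : ℕ → 𝒜 → 𝒜 → Prop := CoresW P fun _ => True

/-- The `P`-dimension of `A` : the infimum of the `n ≥ 0` such that there is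
an exact sequence `0 → C_n → ⋯ → C_1 → C_0 → A → 0` with all `C_i` in `P`
(`⊤ = ∞` if there is no such `n`). -/
noncomputable def rdim (P : 𝒜 → Prop) (A : 𝒜) : ℕ∞ :=
  sInf {c : ℕ∞ | ∃ n : ℕ, c = n ∧ ∃ K, P K ∧ Res P n K A}

/-- The `P`-codimension of `A` : the infimum of the `n ≥ 0` such that there is
an exact sequence `0 → A → C^0 → C^1 → ⋯ → C^n → 0` with all `C^i` in `P`
(`⊤ = ∞` if there is no such `n`). -/
noncomputable def rcodim (P : 𝒜 → Prop) (A : 𝒜) : ℕ∞ :=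
  sInf {c : ℕ∞ | ∃ n : ℕ, c = n ∧ ∃ K, P K ∧ Cores P n A K}

/-- `A` belongs to `P^⊥`, i.e. `Ext^i(C, A) = 0` for all `C` in `P` and `i ≥ 1`. -/
def MemRightPerp [HasExt.{w} 𝒜] (P : 𝒜 → Prop) (A : 𝒜) : Prop :=
  ∀ C, P C → ∀ i : ℕ, 1 ≤ i → Subsingleton (Abelian.Ext C A i)

/-- `A` belongs to `^⊥P`, i.e. `Ext^i(A, C) = 0` for all `C` in `P` and `i ≥ 1`. -/
def MemLeftPerp [HasExt.{w} 𝒜] (P : 𝒜 → Prop) (A : 𝒜) : Prop :=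
  ∀ C, P C → ∀ i : ℕ, 1 ≤ i → Subsingleton (Abelian.Ext A C i)

/-- `𝒞` is an `ℰ`-proper generator for `𝒯` (`𝒞 ⊆ 𝒯` and every object of `𝒯`
is an `ℰ`-proper quotient of an object of `𝒞` with kernel in `𝒯`). -/
def IsProperGenerator (E C T : 𝒜 → Prop) : Prop :=
  (∀ ⦃X⦄, C X → T X) ∧
  ∀ X, T X → ∃ (X' Cb : 𝒜) (f : X' ⟶ Cb) (g : Cb ⟶ X) (w : f ≫ g = 0),
    C Cb ∧ T X' ∧ (ShortComplex.mk f g w).ShortExact ∧ EProper E (ShortComplex.mk f g w)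

/-- `𝒞` is a cogenerator for `𝒯`. -/
def IsCogenerator (C T : 𝒜 → Prop) : Prop :=
  (∀ ⦃X⦄, C X → T X) ∧
  ∀ X, T X → ∃ (Cb X' : 𝒜) (f : X ⟶ Cb) (g : Cb ⟶ X') (w : f ≫ g = 0),
    C Cb ∧ T X' ∧ (ShortComplex.mk f g w).ShortExact

/-- `𝒯` is closed under `ℰ`-proper extensions. -/
def ClosedUnderProperExtensions (E T : 𝒜 → Prop) : Prop :=
  ∀ S : ShortComplex 𝒜, S.ShortExact → EProper E S → T S.X₁ → T S.X₃ → T S.X₂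

/-- `𝒯` is closed under kernels of `ℰ`-proper epimorphisms. -/
def ClosedUnderProperKernels (E T : 𝒜 → Prop) : Prop :=
  ∀ S : ShortComplex 𝒜, S.ShortExact → EProper E S → T S.X₂ → T S.X₃ → T S.X₁

/-- `𝒯` is an `ℰ`-preresolving subcategory with `ℰ`-proper generator `𝒞`. -/
def IsPreresolving (E T C : 𝒜 → Prop) : Prop :=
  IsProperGenerator E C T ∧ ClosedUnderProperExtensions E T


/-- Exactness of a four-term sequence `0 → M → T₁ → T₀ → A → 0`. -/
def FourTermExact {M T1 T0 A : 𝒜} (f : M ⟶ T1) (g : T1 ⟶ T0) (h : T0 ⟶ A) : Prop :=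
  Mono f ∧ Epi h ∧ ∃ (w₁ : f ≫ g = 0) (w₂ : g ≫ h = 0),
    (ShortComplex.mk f g w₁).Exact ∧ (ShortComplex.mk g h w₂).Exact

/-- `Hom(W,-)`-exactness of the four-term exact sequence `0 → M → T₁ → T₀ → A → 0` :
the induced sequence `0 → Hom(W,M) → Hom(W,T₁) → Hom(W,T₀) → Hom(W,A) → 0` is exact. -/
def CovHomExact4 (W : 𝒜) {M T1 T0 A : 𝒜} (f : M ⟶ T1) (g : T1 ⟶ T0) (h : T0 ⟶ A) : Prop :=
  (∀ a b : W ⟶ M, a ≫ f = b ≫ f → a = b) ∧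
  (∀ b : W ⟶ T1, b ≫ g = 0 → ∃ a : W ⟶ M, a ≫ f = b) ∧
  (∀ c : W ⟶ T0, c ≫ h = 0 → ∃ b : W ⟶ T1, b ≫ g = c) ∧
  (∀ d : W ⟶ A, ∃ c : W ⟶ T0, c ≫ h = d)

/-- There is an exact sequence `0 → M → K⁰ → C¹ → ⋯ → Cⁿ → 0` with `K⁰` in `T`
and all `C^i` in `C`. -/
def MixedCores (T C : 𝒜 → Prop) : ℕ → 𝒜 → Prop
  | 0 => fun M => ∃ K, T K ∧ Nonempty (M ≅ K)
  | n + 1 => fun M => ∃ (K H : 𝒜) (f : M ⟶ K) (g : K ⟶ H) (w : f ≫ g = 0),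
      T K ∧ (ShortComplex.mk f g w).ShortExact ∧ ∃ K', C K' ∧ Cores C n H K'

/-- The Gorenstein subcategory `𝒢(𝒞)` : objects `A` admitting a doubly infinite
exact sequence `⋯ → X_{-1} → X_0 → X_1 → ⋯` with all terms in `𝒞`, which is both
`Hom(𝒞,-)`-exact and `Hom(-,𝒞)`-exact, such that `A ≅ Im(X_0 → X_1)`. -/
def IsGorenstein (P : 𝒜 → Prop) (A : 𝒜) : Prop :=
  ∃ (X : ℤ → 𝒜) (d : ∀ i : ℤ, X i ⟶ X (i + 1)) (w : ∀ i, d i ≫ d (i + 1) = 0),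
    (∀ i, P (X i)) ∧
    (∀ i, (ShortComplex.mk (d i) (d (i + 1)) (w i)).Exact) ∧
    (∀ C, P C → ∀ (i : ℤ) (f : C ⟶ X (i + 1)), f ≫ d (i + 1) = 0 →
      ∃ g : C ⟶ X i, g ≫ d i = f) ∧
    (∀ C, P C → ∀ (i : ℤ) (f : X (i + 1) ⟶ C), d i ≫ f = 0 →
      ∃ g : X (i + 1 + 1) ⟶ C, d (i + 1) ≫ g = f) ∧
    Nonempty (A ≅ Limits.image (d 0))


section Modules

variable (R : Type u) [Ring R]

/-- `G` is isomorphic to the image of the middle map of a doubly infinite exact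
sequence of projective `R`-modules which stays exact under `Hom(-, F)` for every
module `F` satisfying `Q`. -/
def IsTotallyAcyclicImageFor (Q : ModuleCat.{u} R → Prop) (G : ModuleCat.{u} R) : Prop :=
  ∃ (X : ℤ → ModuleCat.{u} R) (d : ∀ i : ℤ, X i ⟶ X (i + 1)) (w : ∀ i, d i ≫ d (i + 1) = 0),
    (∀ i, Projective (X i)) ∧
    (∀ i, (ShortComplex.mk (d i) (d (i + 1)) (w i)).Exact) ∧
    (∀ F, Q F → ∀ (i : ℤ) (f : X (i + 1) ⟶ F), d i ≫ f = 0 →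
      ∃ g : X (i + 1 + 1) ⟶ F, d (i + 1) ≫ g = f) ∧
    Nonempty (G ≅ Limits.image (d 0))

/-- Gorenstein projective modules. -/
def IsGorensteinProjective (G : ModuleCat.{u} R) : Prop :=
  IsTotallyAcyclicImageFor R (fun Q => Projective Q) G

/-- Flatness of a left module over an arbitrary ring, via the Lazard–Govorov
characterization: a module is flat iff every homomorphism from a finitely
presented module to it factors through a finitely generated free module. -/
def IsFlatModule (F : ModuleCat.{u} R) : Prop :=
  ∀ (P : ModuleCat.{u} R), Module.FinitePresentation R P → ∀ f : P ⟶ F,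
    ∃ (n : ℕ) (g : P ⟶ ModuleCat.of R (Fin n → R)) (h : ModuleCat.of R (Fin n → R) ⟶ F),
      g ≫ h = f

/-- Strongly Gorenstein flat modules. -/
def IsStronglyGorensteinFlat (G : ModuleCat.{u} R) : Prop :=
  IsTotallyAcyclicImageFor R (fun F => IsFlatModule R F) G

end Modules

end RelHomDim

namespace RelHomDim

variable {𝒜 : Type u} [Category.{v} 𝒜] [Abelian 𝒜]

section ExtVanishing

variable [HasExt.{w} 𝒜]

/-- `Ext^i(A, P) = 0` for every projective object `P` and every `i > m`. -/
def ExtProjVanishesAbove (m : ℕ) (A : 𝒜) : Prop :=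
  ∀ P : 𝒜, Projective P → ∀ i : ℕ, m < i → Subsingleton (Abelian.Ext A P i)

/-- Dimension shifting along a short exact sequence with middle term in `^⊥𝒫`. -/
lemma ExtProjVanishesAbove.of_shortExact {S : ShortComplex 𝒜} (hS : S.ShortExact) {m : ℕ}
    (h₁ : ExtProjVanishesAbove m S.X₁)
    (h₂ : MemLeftPerp (fun P : 𝒜 => Projective P) S.X₂) :
    ExtProjVanishesAbove (m + 1) S.X₃ := by
  intro P hP i hi
  obtain ⟨j, rfl⟩ : ∃ j, i = 1 + j := ⟨i - 1, by lia⟩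
  have := h₁ P hP j (by lia)
  have := h₂ P hP (1 + j) (by lia)
  refine subsingleton_of_forall_eq 0 fun x => ?_
  obtain ⟨y, rfl⟩ := Ext.contravariant_sequence_exact₃ hS P x (Subsingleton.elim _ _) rfl
  rw [Subsingleton.elim y 0, Ext.comp_zero]

/-- The first syzygy lowers the vanishing bound by one, truncated at zero. -/
lemma ExtProjVanishesAbove.syzygy {S : ShortComplex 𝒜} (hS : S.ShortExact) {m : ℕ}
    [Projective S.X₂] (h₃ : ExtProjVanishesAbove m S.X₃) :
    ExtProjVanishesAbove (m - 1) S.X₁ := by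
  intro P hP i hi
  obtain ⟨j, rfl⟩ : ∃ j, i = j + 1 := ⟨i - 1, by lia⟩
  have := h₃ P hP (1 + (j + 1)) (by lia)
  refine subsingleton_of_forall_eq 0 fun x => ?_
  obtain ⟨y, rfl⟩ := Ext.contravariant_sequence_exact₁ hS P x rfl (Subsingleton.elim _ _)
  rw [Ext.eq_zero_of_projective y, Ext.comp_zero]

/-- A `𝒯`-resolution of length `m` with `𝒯 ⊆ ^⊥𝒫` bounds the nonvanishing of `Ext(A, 𝒫)`. -/
lemma extProjVanishesAbove_of_res {T : 𝒜 → Prop}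
    (hiso : ∀ ⦃X Y : 𝒜⦄, (X ≅ Y) → T X → T Y)
    (hT : ∀ M, T M → MemLeftPerp (fun P : 𝒜 => Projective P) M)
    {m : ℕ} {K A : 𝒜} (hK : T K) (hres : Res T m K A) : ExtProjVanishesAbove m A := by
  induction m generalizing A with
  | zero =>
    obtain ⟨e⟩ := hres
    exact hT A (hiso e hK)
  | succ m ih =>
    obtain ⟨B, X, f, g, w, hX, hS, -, hB⟩ := hres
    exact .of_shortExact hS (ih hB) (hT X hX)

/-- A short exact sequence with projective middle term and vanishing `Ext^1` of its ends splits,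
so its quotient is projective. -/
lemma projective_of_shortExact_of_subsingleton_ext {S : ShortComplex 𝒜} (hS : S.ShortExact)
    [Projective S.X₂] [Subsingleton (Abelian.Ext S.X₃ S.X₁ 1)] : Projective S.X₃ := by
  obtain ⟨x, hx⟩ := Ext.covariant_sequence_exact₃ S.X₃ hS (Ext.mk₀ (𝟙 S.X₃)) (zero_add 1)
    (Subsingleton.elim _ _)
  obtain ⟨s, rfl⟩ := (Ext.mk₀_bijective _ _).2 x
  rw [Ext.mk₀_comp_mk₀] at hx
  exact Retract.projective ⟨s, S.g, (Ext.mk₀_bijective _ _).1 hx⟩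

/-- For an object of finite projective dimension, vanishing of `Ext^i(A, 𝒫)` for `i > m`
yields a projective resolution of length at most `m`. -/
lemma exists_projective_res_le {n m : ℕ} {K A : 𝒜} (hK : Projective K)
    (hres : Res (fun P : 𝒜 => Projective P) n K A) (hA : ExtProjVanishesAbove m A) :
    ∃ k ≤ m, ∃ K' : 𝒜, Projective K' ∧ Res (fun P : 𝒜 => Projective P) k K' A := by
  induction n generalizing A m with
  | zero => exact ⟨0, m.zero_le, K, hK, hres⟩
  | succ n ih =>
    obtain ⟨B, X, f, g, w, hX, hS, -, hB⟩ := hres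
    obtain ⟨k, hk, K', hK', hres'⟩ := ih hB (hA.syzygy hS)
    obtain _ | m := m
    · obtain rfl : k = 0 := by lia
      obtain ⟨e⟩ := hres'
      have : Subsingleton (Abelian.Ext A B 1) := hA B (.of_iso e hK') 1 one_pos
      have hAproj : Projective A := projective_of_shortExact_of_subsingleton_ext hS
      exact ⟨0, le_rfl, A, hAproj, ⟨Iso.refl A⟩⟩
    · exact ⟨k + 1, by lia, K', hK', B, X, f, g, w, hX, hS, trivial, hres'⟩

end ExtVanishing

lemma ResW.mono {P Q : 𝒜 → Prop} {W : ShortComplex 𝒜 → Prop} (h : ∀ X, P X → Q X)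
    {n : ℕ} {K A : 𝒜} (hres : ResW P W n K A) : ResW Q W n K A := by
  induction n generalizing A with
  | zero => exact hres
  | succ n ih =>
    obtain ⟨B, X, f, g, w, hX, hS, hW, hB⟩ := hres
    exact ⟨B, X, f, g, w, h X hX, hS, hW, ih hB⟩

lemma rdim_anti {P Q : 𝒜 → Prop} (h : ∀ X, P X → Q X) (A : 𝒜) : rdim Q A ≤ rdim P A := by
  refine sInf_le_sInf ?_
  rintro _ ⟨n, rfl, K, hK, hres⟩
  exact ⟨n, rfl, K, h K hK, hres.mono h⟩

end RelHomDim

open RelHomDim in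
/-- Proposition 5.3(1). -/
theorem stmt17 (R : Type u) [Ring R] [HasExt.{w} (ModuleCat.{u} R)]
    (𝒯 : ModuleCat.{u} R → Prop) (h𝒯 : IsAdditiveClass 𝒯)
    (hext : ∀ S : ShortComplex (ModuleCat.{u} R), S.ShortExact →
      𝒯 S.X₁ → 𝒯 S.X₃ → 𝒯 S.X₂)
    (hPT : ∀ M : ModuleCat.{u} R, Projective M → 𝒯 M)
    (hTP : ∀ M : ModuleCat.{u} R, 𝒯 M →
      MemLeftPerp (fun P : ModuleCat.{u} R => Projective P) M)
    (A : ModuleCat.{u} R)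
    (hA : rdim (fun P : ModuleCat.{u} R => Projective P) A < ⊤) :
    rdim (fun P : ModuleCat.{u} R => Projective P) A = rdim 𝒯 A := by
  refine le_antisymm (le_sInf ?_) (rdim_anti hPT A)
  rintro _ ⟨m, rfl, K, hK, hres⟩
  obtain ⟨_, ⟨n, rfl, L, hL, hresL⟩, -⟩ := sInf_lt_iff.1 hA
  obtain ⟨k, hk, K', hK', hres'⟩ := exists_projective_res_le hL hresL
    (extProjVanishesAbove_of_res h𝒯.2.1 hTP hK hres)
  exact sInf_le_of_le ⟨k, rfl, K', hK', hres'⟩ (Nat.cast_le.2 hk)
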